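/- arXiv:math-ph/0403003 — 2 statements merged into one kernel-verified Lean document; each statement's English description precedes it below -/
import Mathlib

section
/- If ⦀μ₁ − μ₂⦀ₚ = 0 for the weak p-Wasserstein distance, then μ₁ = μ₂. -/
open MeasureTheory ENNReal

/-- The set of couplings of two measures. -/
def Couplings {B : Type*} [MeasurableSpace B] (μ₁ μ₂ : Measure B) : Set (Measure (B × B)) :=
  {π | π.map Prod.fst = μ₁ ∧ π.map Prod.snd = μ₂}

/-- The `p`-th power of the weak `p`-Wasserstein distance:
`⦀μ₁ − μ₂⦀ₚᵖ = sup_{ℓ ∈ B*, ℓ ≠ 0} inf_{couplings π} ∫ |ℓ x − ℓ y|ᵖ / ‖ℓ‖ᵖ dπ`. -/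
noncomputable def weakWassPow {B : Type*} [NormedAddCommGroup B] [NormedSpace ℝ B]
    [MeasurableSpace B] (p : ℝ) (μ₁ μ₂ : Measure B) : ℝ≥0∞ :=
  ⨆ ℓ : {ℓ : B →L[ℝ] ℝ // ℓ ≠ 0},
    ⨅ π : Couplings μ₁ μ₂,
      ∫⁻ z, ENNReal.ofReal (|ℓ.1 z.1 - ℓ.1 z.2| ^ p / ‖ℓ.1‖ ^ p) ∂π.1

/-- The weak `p`-Wasserstein distance `⦀μ₁ − μ₂⦀ₚ`. -/
noncomputable def weakWass {B : Type*} [NormedAddCommGroup B] [NormedSpace ℝ B]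
    [MeasurableSpace B] (p : ℝ) (μ₁ μ₂ : Measure B) : ℝ≥0∞ :=
  (weakWassPow p μ₁ μ₂) ^ (1 / p)

/-- Characteristic functions are controlled by the transport cost along any coupling. -/
lemma charFunDual_sub_le {B : Type*} [NormedAddCommGroup B] [NormedSpace ℝ B]
    [SecondCountableTopology B] [MeasurableSpace B] [BorelSpace B]
    (p : ℝ) (hp : 1 ≤ p) (μ₁ μ₂ : Measure B) [IsProbabilityMeasure μ₁]
    (ℓ : B →L[ℝ] ℝ) (π : Measure (B × B)) (hπ : π ∈ Couplings μ₁ μ₂) :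
    ‖charFunDual μ₁ ℓ - charFunDual μ₂ ℓ‖ₑ ^ p ≤ ∫⁻ z, ENNReal.ofReal (|ℓ z.1 - ℓ z.2| ^ p) ∂π := by
  obtain ⟨h1, h2⟩ := hπ
  have hp0 : 0 < p := by linarith
  have : IsProbabilityMeasure π := by
    constructor
    have := measure_univ (μ := μ₁)
    rwa [← h1, Measure.map_apply measurable_fst MeasurableSet.univ, Set.preimage_univ] at this
  have e1 : charFunDual μ₁ ℓ = ∫ z, Complex.exp (ℓ z.1 * Complex.I) ∂π := by
    rw [charFunDual_apply, ← h1, integral_map (by fun_prop)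
      (Measurable.aestronglyMeasurable (by fun_prop))]
  have e2 : charFunDual μ₂ ℓ = ∫ z, Complex.exp (ℓ z.2 * Complex.I) ∂π := by
    rw [charFunDual_apply, ← h2, integral_map (by fun_prop)
      (Measurable.aestronglyMeasurable (by fun_prop))]
  have i1 : Integrable (fun z : B × B => Complex.exp (ℓ z.1 * Complex.I)) π :=
    Integrable.of_bound (C := 1) (Measurable.aestronglyMeasurable (by fun_prop))
      (by simp [Complex.norm_exp_ofReal_mul_I])
  have i2 : Integrable (fun z : B × B => Complex.exp (ℓ z.2 * Complex.I)) π :=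
    Integrable.of_bound (C := 1) (Measurable.aestronglyMeasurable (by fun_prop))
      (by simp [Complex.norm_exp_ofReal_mul_I])
  have b1 : ‖charFunDual μ₁ ℓ - charFunDual μ₂ ℓ‖ₑ ≤ ∫⁻ z, ‖ℓ z.1 - ℓ z.2‖ₑ ∂π := by
    rw [e1, e2, ← integral_sub i1 i2]
    refine (enorm_integral_le_lintegral_enorm _).trans (lintegral_mono fun z => ?_)
    rw [enorm_le_iff_norm_le]
    have hz : Complex.exp (ℓ z.1 * Complex.I) - Complex.exp (ℓ z.2 * Complex.I)
        = Complex.exp (ℓ z.2 * Complex.I) *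
          (Complex.exp (Complex.I * ((ℓ z.1 - ℓ z.2 : ℝ) : ℂ)) - 1) := by
      rw [mul_sub, ← Complex.exp_add, mul_one]
      congr 2
      push_cast
      ring
    rw [hz, norm_mul, Complex.norm_exp_ofReal_mul_I, one_mul]
    exact Real.norm_exp_I_mul_ofReal_sub_one_le
  have b2 := eLpNorm'_le_eLpNorm'_of_exponent_le (f := fun z : B × B => ℓ z.1 - ℓ z.2)
    one_pos hp π (Measurable.aestronglyMeasurable (by fun_prop))
  simp only [eLpNorm', ENNReal.rpow_one, div_one] at b2
  have b3 := ENNReal.rpow_le_rpow (b1.trans b2) hp0.le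
  rw [← ENNReal.rpow_mul, one_div_mul_cancel hp0.ne', ENNReal.rpow_one] at b3
  refine b3.trans (le_of_eq (lintegral_congr fun z => ?_))
  rw [Real.enorm_eq_ofReal_abs, ENNReal.ofReal_rpow_of_nonneg (abs_nonneg _) hp0.le]

/-- if the weak `p`-Wasserstein distance between two Borel probability
measures with finite `p`-moments on a separable Banach space vanishes, the measures
coincide. -/
theorem eq_of_weakWass_eq_zero
    {B : Type*} [NormedAddCommGroup B] [NormedSpace ℝ B] [CompleteSpace B]
    [TopologicalSpace.SeparableSpace B] [MeasurableSpace B] [BorelSpace B]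
    (p : ℝ) (hp : 1 ≤ p) (μ₁ μ₂ : Measure B)
    [IsProbabilityMeasure μ₁] [IsProbabilityMeasure μ₂]
    (hmom₁ : ∫⁻ x, ENNReal.ofReal (‖x‖ ^ p) ∂μ₁ < ∞)
    (hmom₂ : ∫⁻ x, ENNReal.ofReal (‖x‖ ^ p) ∂μ₂ < ∞)
    (h : weakWass p μ₁ μ₂ = 0) :
    μ₁ = μ₂ := by
  have hp0 : 0 < p := by linarith
  have : SecondCountableTopology B := UniformSpace.secondCountable_of_separable B
  have h0 : weakWassPow p μ₁ μ₂ = 0 := by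
    rw [weakWass, ENNReal.rpow_eq_zero_iff] at h
    rcases h with h | h
    · exact h.1
    · have : 0 < 1 / p := by positivity
      linarith [h.2]
  refine Measure.ext_of_charFunDual (funext fun ℓ => ?_)
  by_cases hℓ : ℓ = 0
  · subst hℓ
    simp [charFunDual_apply]
  have hinf := (iSup_eq_bot.mp h0) ⟨ℓ, hℓ⟩
  have hn : 0 < ‖ℓ‖ ^ p := Real.rpow_pos_of_pos (norm_pos_iff.mpr hℓ) p
  have key : ‖charFunDual μ₁ ℓ - charFunDual μ₂ ℓ‖ₑ ^ p / ENNReal.ofReal (‖ℓ‖ ^ p) ≤ ⊥ := by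
    rw [← hinf]
    refine le_iInf fun π => ?_
    rw [ENNReal.div_le_iff (by simpa using hn) ENNReal.ofReal_ne_top,
      ← lintegral_mul_const' _ _ ENNReal.ofReal_ne_top]
    refine (charFunDual_sub_le p hp μ₁ μ₂ ℓ π.1 π.2).trans
      (le_of_eq (lintegral_congr fun z => ?_))
    rw [← ENNReal.ofReal_mul (by positivity), div_mul_cancel₀ _ hn.ne']
  have key2 := le_bot_iff.mp key
  rw [ENNReal.bot_eq_zero, ENNReal.div_eq_zero_iff] at key2
  have key3 := key2.resolve_right ENNReal.ofReal_ne_top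
  rw [ENNReal.rpow_eq_zero_iff_of_pos hp0, enorm_eq_zero] at key3
  exact sub_eq_zero.mp key3
end

section
/- There exists a sequence of centered Gaussian measures (μ_m) on ℓ² that is Cauchy with respect to the weak p-Wasserstein distance ⦀·⦀ₚ but does not converge weakly to any Borel probability measure on ℓ². Specifically, one can take μ_m to be the centered Gaussian measure on ℓ² with diagonal covariance Q_m = diag(1, 1/2, …, 1/m, 0, 0, …). -/
open MeasureTheory ENNReal Filter Topology ProbabilityTheory

/-- The sequence space `ℓ²`. -/
abbrev EllTwo : Type := lp (fun _ : ℕ => ℝ) 2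


namespace WeakWassAux

/-- Law of an i.i.d. standard Gaussian sequence. -/
noncomputable def P : Measure (ℕ → ℝ) := Measure.infinitePi (fun _ : ℕ => gaussianReal 0 1)

instance : IsProbabilityMeasure P := by unfold P; infer_instance

lemma map_lin (s : Finset ℕ) (c : ℕ → ℝ) :
    P.map (fun ω => ∑ i ∈ s, c i * ω i) = gaussianReal 0 (Real.toNNReal (∑ i ∈ s, c i ^ 2)) := by
  have : IsProbabilityMeasure (P.map (fun ω => ∑ i ∈ s, c i * ω i)) :=
    Measure.isProbabilityMeasure_map (Measurable.aemeasurable (by fun_prop))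
  have hind : iIndepFun (fun i (ω : ℕ → ℝ) => c i * ω i) P :=
    iIndepFun_infinitePi (X := fun i x => c i * x) (fun i => by fun_prop)
  have hlaw : ∀ i, P.map (fun ω : ℕ → ℝ => c i * ω i)
      = gaussianReal (c i * 0) (.mk (c i ^ 2) (sq_nonneg _) * 1) := by
    intro i
    rw [← gaussianReal_map_const_mul, ← Measure.infinitePi_map_eval (fun _ : ℕ => gaussianReal 0 1) i,
      Measure.map_map (by fun_prop) (by fun_prop)]
    rfl
  refine Measure.ext_of_charFun ?_
  rw [iIndepFun.charFun_map_fun_finsetSum_eq_prod (X := fun i (ω : ℕ → ℝ) => c i * ω i)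
    (fun i _ => Measurable.aemeasurable (by fun_prop)) (hind.restrict s)]
  ext t
  rw [Finset.prod_apply]
  simp only [hlaw, charFun_gaussianReal]
  rw [← Complex.exp_sum]
  congr 1
  rw [Real.coe_toNNReal _ (Finset.sum_nonneg fun i _ => sq_nonneg _)]
  push_cast
  simp [Finset.sum_mul, Finset.sum_div]

/-- The partial sums. -/
noncomputable def X (m : ℕ) (ω : ℕ → ℝ) : EllTwo :=
  ∑ i ∈ Finset.range m, ((Real.sqrt (i + 1))⁻¹ * ω i) • lp.single 2 i (1 : ℝ)

lemma continuous_X (m : ℕ) : Continuous (X m) := by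
  unfold X; fun_prop

lemma apply_X (m : ℕ) (L : EllTwo →L[ℝ] ℝ) (ω : ℕ → ℝ) :
    L (X m ω) = ∑ i ∈ Finset.range m, ((Real.sqrt (i + 1))⁻¹ * L (lp.single 2 i 1)) * ω i := by
  unfold X
  rw [map_sum]
  refine Finset.sum_congr rfl fun i _ => ?_
  rw [map_smul, smul_eq_mul]; ring

lemma norm_sq_sum (s : Finset ℕ) (a : ℕ → ℝ) :
    ‖∑ i ∈ s, a i • (lp.single 2 i (1 : ℝ) : EllTwo)‖ ^ 2 = ∑ i ∈ s, a i ^ 2 := by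
  have h := lp.norm_sum_single (E := fun _ : ℕ => ℝ) (p := 2) (by norm_num) a s
  have h2 : ∀ i, a i • (lp.single 2 i (1 : ℝ) : EllTwo) = lp.single 2 i (a i) := by
    intro i
    rw [← lp.single_smul]; simp
  simp only [h2]
  simpa using h

lemma bessel (L : EllTwo →L[ℝ] ℝ) (s : Finset ℕ) :
    ∑ i ∈ s, (L (lp.single 2 i 1)) ^ 2 ≤ ‖L‖ ^ 2 := by
  set S := ∑ i ∈ s, (L (lp.single 2 i 1)) ^ 2 with hS
  have hS0 : 0 ≤ S := Finset.sum_nonneg fun i _ => sq_nonneg _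
  have hn := norm_sq_sum s (fun i => L (lp.single 2 i 1))
  set v : EllTwo := ∑ i ∈ s, L (lp.single 2 i 1) • (lp.single 2 i (1 : ℝ) : EllTwo) with hv
  have hLv : L v = S := by
    rw [hv, map_sum, hS]
    refine Finset.sum_congr rfl fun i _ => ?_
    rw [map_smul, smul_eq_mul]; ring
  have h1 : S ≤ ‖L‖ * ‖v‖ := by
    have := L.le_opNorm v
    rw [hLv, Real.norm_eq_abs] at this
    exact (le_abs_self _).trans this
  have hn' : ‖v‖ ^ 2 = S := hn
  have h2 : S ^ 2 ≤ ‖L‖ ^ 2 * S := by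
    rw [← hn', ← mul_pow, hn']
    exact pow_le_pow_left₀ hS0 h1 2
  rcases hS0.eq_or_lt with h | h
  · rw [← h]; positivity
  · nlinarith

lemma sq_inv_sqrt (i : ℕ) : ((Real.sqrt (i + 1))⁻¹) ^ 2 = 1 / (i + 1 : ℝ) := by
  rw [inv_pow, Real.sq_sqrt (by positivity), one_div]

/-- absolute moment -/
noncomputable def C (p : ℝ) : ℝ≥0∞ := ∫⁻ x, ENNReal.ofReal (|x| ^ p) ∂(gaussianReal 0 1)

lemma C_ne_top (p : ℝ) (hp : 1 ≤ p) : C p ≠ ∞ := by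
  have h := (memLp_id_gaussianReal' (μ := 0) (v := 1) (ENNReal.ofReal p) (by simp)).integrable_norm_rpow
    (by simp; linarith) (by simp)
  rw [ENNReal.toReal_ofReal (by linarith)] at h
  exact (h.lintegral_lt_top).ne

lemma moment (p : ℝ) (hp : 1 ≤ p) (v : ℝ) (n r : ℝ) (hn : 0 < n)
    (hr : 0 ≤ r) (h : v ≤ (r * n) ^ 2) :
    ∫⁻ x, ENNReal.ofReal (|x| ^ p / n ^ p) ∂(gaussianReal 0 (Real.toNNReal v))
      ≤ ENNReal.ofReal (r ^ p) * C p := by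
  have hg : gaussianReal 0 (Real.toNNReal v) = (gaussianReal 0 1).map (Real.sqrt v * ·) := by
    rw [gaussianReal_map_const_mul]
    congr 1
    · simp
    · ext
      rcases le_total 0 v with hv | hv
      · simp [hv]
      · simp [hv, Real.sqrt_eq_zero_of_nonpos hv]
  rw [hg, lintegral_map (by fun_prop) (by fun_prop), C, ← lintegral_const_mul _ (by fun_prop)]
  refine lintegral_mono fun x => ?_
  rw [← ENNReal.ofReal_mul (by positivity)]
  apply ENNReal.ofReal_le_ofReal
  have hs : Real.sqrt v ≤ r * n := Real.sqrt_le_iff.2 ⟨by positivity, h⟩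
  rw [div_le_iff₀ (by positivity), abs_mul, abs_of_nonneg (Real.sqrt_nonneg v)]
  calc (Real.sqrt v * |x|) ^ p ≤ ((r * n) * |x|) ^ p := by
        apply Real.rpow_le_rpow (by positivity) _ (by linarith)
        gcongr
    _ = r ^ p * |x| ^ p * n ^ p := by
        rw [Real.mul_rpow (by positivity) (by positivity), Real.mul_rpow hr hn.le]; ring

lemma wass_bound [MeasurableSpace EllTwo] [BorelSpace EllTwo] (p : ℝ) (hp : 1 ≤ p) (N m k : ℕ)
    (hm : N ≤ m) (hk : N ≤ k) :
    weakWassPow p (P.map (X m)) (P.map (X k)) ≤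
      ENNReal.ofReal (((Real.sqrt (N + 1))⁻¹) ^ p) * C p := by
  refine iSup_le fun ℓ => ?_
  obtain ⟨L, hL⟩ := ℓ
  have hXm := (continuous_X m).measurable
  have hXk := (continuous_X k).measurable
  have hLm : Measurable L := L.continuous.measurable
  refine (iInf_le _ (⟨P.map (fun ω => (X m ω, X k ω)), ?_, ?_⟩ : Couplings _ _)).trans ?_
  · rw [Measure.map_map measurable_fst (hXm.prodMk hXk)]; rfl
  · rw [Measure.map_map measurable_snd (hXm.prodMk hXk)]; rfl
  dsimp only
  have h1 : Measurable fun z : EllTwo × EllTwo => L z.1 := hLm.comp measurable_fst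
  have h2 : Measurable fun z : EllTwo × EllTwo => L z.2 := hLm.comp measurable_snd
  rw [lintegral_map (by fun_prop) (hXm.prodMk hXk)]
  let c : ℕ → ℝ := fun i => (Real.sqrt (i + 1))⁻¹ * L (lp.single 2 i 1)
  let d : ℕ → ℝ := fun i => (if i < m then c i else 0) - (if i < k then c i else 0)
  have key : ∀ n ≤ max m k, ∀ ω, L (X n ω)
      = ∑ i ∈ Finset.range (max m k), (if i < n then c i else 0) * ω i := by
    intro n hn ω
    rw [apply_X]
    have : Finset.range n = (Finset.range (max m k)).filter (· < n) := by
      ext i; simp only [Finset.mem_range, Finset.mem_filter]; omega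
    rw [this, Finset.sum_filter]
    refine Finset.sum_congr rfl fun i _ => ?_
    split_ifs <;> simp [c]
  have hd : ∀ ω, L (X m ω) - L (X k ω) = ∑ i ∈ Finset.range (max m k), d i * ω i := by
    intro ω
    rw [key m (le_max_left _ _), key k (le_max_right _ _), ← Finset.sum_sub_distrib]
    refine Finset.sum_congr rfl fun i _ => ?_
    simp only [d]; ring
  simp only [hd]
  rw [← lintegral_map (μ := P) (f := fun x => ENNReal.ofReal (|x| ^ p / ‖L‖ ^ p))
    (g := fun ω => ∑ i ∈ Finset.range (max m k), d i * ω i) (by fun_prop) (by fun_prop), map_lin]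
  refine moment p hp _ _ _ (norm_pos_iff.2 hL) (by positivity) ?_
  rw [mul_pow, sq_inv_sqrt]
  refine le_trans ?_ (mul_le_mul_of_nonneg_left (bessel L (Finset.range (max m k))) (by positivity))
  rw [Finset.mul_sum]
  refine Finset.sum_le_sum fun i _ => ?_
  have hc : c i ^ 2 = 1 / (i + 1 : ℝ) * L (lp.single 2 i 1) ^ 2 := by
    simp only [c]; rw [mul_pow, sq_inv_sqrt]
  by_cases hi : i < N
  · have : d i = 0 := by simp [d, hi.trans_le hm, hi.trans_le hk]
    rw [this, zero_pow two_ne_zero]; positivity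
  · have : d i ^ 2 ≤ c i ^ 2 := by
      simp only [d]
      split_ifs <;> nlinarith [sq_nonneg (c i)]
    refine this.trans ?_
    rw [hc]
    have : (N : ℝ) ≤ i := by exact_mod_cast not_lt.1 hi
    gcongr

lemma gauss_int (a : ℝ) (ha : 0 ≤ a) :
    ∫ x, Real.exp (-(a * x ^ 2 / 2)) ∂(gaussianReal 0 1) = (Real.sqrt (1 + a))⁻¹ := by
  rw [integral_gaussianReal_eq_integral_smul one_ne_zero]
  have : ∀ x : ℝ, gaussianPDFReal 0 1 x • Real.exp (-(a * x ^ 2 / 2))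
      = (Real.sqrt (2 * Real.pi))⁻¹ * Real.exp (-((1 + a) / 2) * x ^ 2) := by
    intro x
    simp only [gaussianPDFReal, smul_eq_mul, NNReal.coe_one, mul_one, sub_zero]
    rw [mul_assoc, ← Real.exp_add]
    congr 2; ring
  simp only [this]
  rw [integral_const_mul, integral_gaussian, ← Real.sqrt_inv, ← Real.sqrt_inv,
    ← Real.sqrt_mul (by positivity)]
  congr 1
  have := Real.pi_pos
  field_simp

lemma exp_int (m : ℕ) :
    ∫ ω, Real.exp (-(‖X m ω‖ ^ 2 / 2)) ∂P = (Real.sqrt (m + 1))⁻¹ := by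
  let g : ℕ → ℝ → ℝ := fun i x => Real.exp (-((1 / (i + 1 : ℝ)) * x ^ 2 / 2))
  have h1 : ∀ ω, Real.exp (-(‖X m ω‖ ^ 2 / 2)) = ∏ i : Fin m, g i (ω i) := by
    intro ω
    rw [Fin.prod_univ_eq_prod_range (fun i => g i (ω i)), X, norm_sq_sum]
    simp only [g]
    rw [← Real.exp_sum, Finset.sum_neg_distrib, Finset.sum_div]
    congr 2
    refine Finset.sum_congr rfl fun i _ => ?_
    rw [mul_pow, sq_inv_sqrt]
  have hind : iIndepFun (fun i (ω : ℕ → ℝ) => ω i) P :=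
    iIndepFun_infinitePi (X := fun i x => x) (fun i => by fun_prop)
  have hind' : iIndepFun (fun (i : Fin m) (ω : ℕ → ℝ) => ω i) P :=
    hind.precomp Fin.val_injective
  have hg : ∀ i, Measurable (g i) := fun i => by simp only [g]; fun_prop
  simp only [h1]
  rw [hind'.integral_fun_prod_comp (f := fun i : Fin m => g i) (fun i => (measurable_pi_apply _).aemeasurable)
    (fun i => (hg i).aestronglyMeasurable)]
  have h2 : ∀ i : ℕ, ∫ ω, g i (ω i) ∂P = (Real.sqrt (1 + 1 / (i + 1 : ℝ)))⁻¹ := by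
    intro i
    rw [← gauss_int _ (by positivity), ← Measure.infinitePi_map_eval (fun _ : ℕ => gaussianReal 0 1) i,
      integral_map (measurable_pi_apply _).aemeasurable (by fun_prop)]
    rfl
  simp only [h2]
  rw [Fin.prod_univ_eq_prod_range (fun i => (Real.sqrt (1 + 1 / (i + 1 : ℝ)))⁻¹)]
  induction m with
  | zero => simp
  | succ n ih =>
    rw [Finset.prod_range_succ, Finset.prod_range_induction _ (fun n => (Real.sqrt (n + 1))⁻¹)]
    · rw [← mul_inv, ← Real.sqrt_mul (by positivity)]
      congr 2; push_cast; field_simp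
    · simp
    · intro k
      rw [← mul_inv, ← Real.sqrt_mul (by positivity)]
      intro _
      congr 2; push_cast; field_simp

lemma tendsto_inv_sqrt : Tendsto (fun n : ℕ => (Real.sqrt (n + 1))⁻¹) atTop (𝓝 0) := by
  refine tendsto_inv_atTop_zero.comp (Real.tendsto_sqrt_atTop.comp ?_)
  exact tendsto_atTop_add_const_right _ _ tendsto_natCast_atTop_atTop

end WeakWassAux

open WeakWassAux

/-- there is a sequence of centered Gaussian measures on `ℓ²`
(with diagonal covariances `Q_m = diag(1, 1/2, …, 1/m, 0, …)`) that is Cauchy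
for the weak `p`-Wasserstein distance but does not converge weakly to any Borel
probability measure on `ℓ²`. -/
theorem weakWass_cauchy_not_weakly_convergent
    [MeasurableSpace EllTwo] [BorelSpace EllTwo] (p : ℝ) (hp : 1 ≤ p) :
    ∃ μ : ℕ → ProbabilityMeasure EllTwo,
      -- μ m is the centered Gaussian measure with covariance
      -- Q_m = diag(1, 1/2, …, 1/m, 0, …): every continuous linear functional
      -- has a centered Gaussian law with the corresponding variance
      (∀ m : ℕ, ∀ L : EllTwo →L[ℝ] ℝ,
        Measure.map L (μ m : Measure EllTwo) =
          gaussianReal 0 (Real.toNNReal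
            (∑ i ∈ Finset.range m, (1 / (i + 1 : ℝ)) * (L (lp.single 2 i 1)) ^ 2))) ∧
      -- Cauchy with respect to the weak p-Wasserstein distance
      (∀ δ > (0:ℝ), ∃ N : ℕ, ∀ m ≥ N, ∀ k ≥ N,
        weakWass p (μ m : Measure EllTwo) (μ k : Measure EllTwo) ≤
          ENNReal.ofReal δ) ∧
      -- but no weak limit exists
      ¬ ∃ ν : ProbabilityMeasure EllTwo, Tendsto μ atTop (𝓝 ν) := by
  have hX : ∀ m, Measurable (X m) := fun m => (continuous_X m).measurable
  refine ⟨fun m => ⟨WeakWassAux.P.map (X m),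
    Measure.isProbabilityMeasure_map (hX m).aemeasurable⟩, ?_, ?_, ?_⟩
  · intro m L
    change Measure.map L (WeakWassAux.P.map (X m)) = _
    rw [Measure.map_map L.continuous.measurable (hX m)]
    have : (L ∘ X m) = fun ω => ∑ i ∈ Finset.range m,
        ((Real.sqrt (i + 1))⁻¹ * L (lp.single 2 i 1)) * ω i := by
      funext ω; exact apply_X m L ω
    rw [this, map_lin]
    simp only [mul_pow, sq_inv_sqrt]
  · intro δ hδ
    have ht : Tendsto (fun N : ℕ => ENNReal.ofReal (((Real.sqrt (N + 1))⁻¹) ^ p) * C p)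
        atTop (𝓝 0) := by
      have h1 := tendsto_inv_sqrt.rpow_const (p := p) (Or.inr (by linarith))
      rw [Real.zero_rpow (by linarith)] at h1
      have h2 := ENNReal.tendsto_ofReal h1
      have h3 := ENNReal.Tendsto.mul_const h2 (Or.inr (C_ne_top p hp))
      simpa using h3
    have hpos : (0 : ℝ≥0∞) < ENNReal.ofReal δ ^ p :=
      ENNReal.rpow_pos (by simpa using hδ) (by simp)
    obtain ⟨N, hN⟩ := (ht.eventually_lt_const hpos).exists
    refine ⟨N, fun m hm k hk => ?_⟩
    have hb := (wass_bound p hp N m k hm hk).trans hN.le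
    unfold weakWass
    rw [one_div]
    exact (ENNReal.rpow_inv_le_iff (by linarith)).2 hb
  · rintro ⟨ν, hν⟩
    have hν := ProbabilityMeasure.tendsto_iff_forall_integral_tendsto.1 hν
    have hcont : Continuous fun x : EllTwo => Real.exp (-(‖x‖ ^ 2 / 2)) := by fun_prop
    have hbd : ∀ x : EllTwo, ‖Real.exp (-(‖x‖ ^ 2 / 2))‖ ≤ 1 := by
      intro x
      rw [Real.norm_eq_abs, Real.abs_exp, Real.exp_le_one_iff]
      have := sq_nonneg ‖x‖
      linarith
    let F : BoundedContinuousFunction EllTwo ℝ :=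
      BoundedContinuousFunction.ofNormedAddCommGroup _ hcont 1 hbd
    have hF := hν F
    have hval : ∀ m : ℕ, ∫ x, F x ∂(WeakWassAux.P.map (X m)) = (Real.sqrt (m + 1))⁻¹ := by
      intro m
      rw [← exp_int, integral_map_of_stronglyMeasurable (hX m)
        (F.continuous.stronglyMeasurable)]
      rfl
    have hF' : Tendsto (fun n : ℕ => (Real.sqrt (n + 1))⁻¹) atTop
        (𝓝 (∫ x, F x ∂(ν : Measure EllTwo))) := by
      refine hF.congr fun m => ?_
      exact hval m
    have h0 := tendsto_nhds_unique hF' tendsto_inv_sqrt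
    have hpos : 0 < ∫ x, F x ∂(ν : Measure EllTwo) :=
      integral_exp_pos (μ := (ν : Measure EllTwo)) (f := fun x => -(‖x‖ ^ 2 / 2))
        (F.integrable _)
    linarith
end
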